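/- arXiv:1609.02695 — 4 statements merged into one kernel-verified Lean document; each statement's English description precedes it below -/
import Mathlib

section
/- Let r ≥ 2 and let β₁ ≥ β₂ ≥ … ≥ β_r ≥ 0 be integers. If β_i > β_{i+1} for some index i with 1 ≤ i ≤ r−1, then D_r(β₁,…,β_r) ≥ binom(r,i), the binomial coefficient r choose i. -/
open Finset

/-- Weyl dimension formula `D_r` for `sl(r)`, applied to the entries
`β 0, …, β (r-1)` (0-indexed versions of `β₁, …, β_r`). -/
def slDim (r : ℕ) (β : ℕ → ℚ) : ℚ :=
  ∏ i ∈ Finset.range r, ∏ j ∈ Finset.range r,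
    if i < j then ((j : ℚ) - (i : ℚ) + β i - β j) / ((j : ℚ) - (i : ℚ)) else 1

/-- Weyl dimension formula `C_m` for `sp(2m)`. -/
def spDim (m : ℕ) (β : ℕ → ℚ) : ℚ :=
  slDim m β *
    ∏ i ∈ Finset.range m, ∏ j ∈ Finset.range m,
      if i ≤ j then
        ((2 * m : ℚ) - (i : ℚ) - (j : ℚ) + β i + β j) /
          ((2 * m : ℚ) - (i : ℚ) - (j : ℚ))
      else 1

/-- Weyl dimension formula `B_m` for `so(2m+1)`. -/
def soOddDim (m : ℕ) (β : ℕ → ℚ) : ℚ :=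
  slDim m β *
    ∏ i ∈ Finset.range m, ∏ j ∈ Finset.range m,
      if i ≤ j then
        ((2 * m : ℚ) - 1 - (i : ℚ) - (j : ℚ) + β i + β j) /
          ((2 * m : ℚ) - 1 - (i : ℚ) - (j : ℚ))
      else 1

/-- Weyl dimension formula `E_m` for `so(2m)`. -/
def soEvenDim (m : ℕ) (β : ℕ → ℚ) : ℚ :=
  slDim m β *
    ∏ i ∈ Finset.range m, ∏ j ∈ Finset.range m,
      if i < j then
        ((2 * m : ℚ) - 2 - (i : ℚ) - (j : ℚ) + β i + β j) /
          ((2 * m : ℚ) - 2 - (i : ℚ) - (j : ℚ))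
      else 1

/-- The tuple determined by a list, extended by zeros. -/
def lw (l : List ℚ) : ℕ → ℚ := fun i => l.getD i 0

/-- `β₁ + ⋯ + β_k` (the sum of the first `k` entries). -/
def headSum (k : ℕ) (β : ℕ → ℚ) : ℚ := ∑ i ∈ Finset.range k, β i

/-- A weight for the ordinary Grassmannian `Gr(k,n)`: integers
`β₁ ≥ β₂ ≥ ⋯ ≥ β_n = 0`, extended by zeros beyond position `n`. -/
def IsGrWeight (n : ℕ) (β : ℕ → ℚ) : Prop :=
  (∀ i, ∃ z : ℤ, β i = (z : ℚ)) ∧ (∀ i j, i ≤ j → β j ≤ β i) ∧ ∀ i, n - 1 ≤ i → β i = 0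

/-- `rank(β) = D_k(β₁,…,β_k) ⬝ D_{n-k}(β_{k+1},…,β_n)` on `Gr(k,n)`. -/
def grRank (k n : ℕ) (β : ℕ → ℚ) : ℚ := slDim k β * slDim (n - k) (fun i => β (k + i))

/-- `dex(β) = (|β|₁/k − |β|₂/(n−k)) ⬝ rank(β)` on `Gr(k,n)`. -/
def grDex (k n : ℕ) (β : ℕ → ℚ) : ℚ :=
  (headSum k β / (k : ℚ) -
      (∑ i ∈ Finset.range (n - k), β (k + i)) / ((n : ℚ) - (k : ℚ))) * grRank k n β

/-- A weight for the symplectic Grassmannian `IGr(k,2n)`: integers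
`β₁ ≥ ⋯ ≥ β_n ≥ 0`, extended by zeros beyond position `n`. -/
def IsIGrWeight (n : ℕ) (β : ℕ → ℚ) : Prop :=
  (∀ i, ∃ z : ℤ, β i = (z : ℚ)) ∧ (∀ i j, i ≤ j → β j ≤ β i) ∧ ∀ i, n ≤ i → β i = 0

/-- `rank(β) = D_k(β₁,…,β_k) ⬝ C_{n-k}(β_{k+1},…,β_n)` on `IGr(k,2n)`. -/
def igrRank (k n : ℕ) (β : ℕ → ℚ) : ℚ := slDim k β * spDim (n - k) (fun i => β (k + i))

/-- `dex(β) = ((β₁+⋯+β_k)/k) ⬝ rank(β)` on `IGr(k,2n)`. -/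
def igrDex (k n : ℕ) (β : ℕ → ℚ) : ℚ := headSum k β / (k : ℚ) * igrRank k n β

/-- A weight for the odd orthogonal Grassmannian `OGr(k,2n+1)`:
`β₁ ≥ ⋯ ≥ β_n ≥ 0`, all entries integers or all half-odd-integers,
extended by zeros beyond position `n`. -/
def IsOGrOddWeight (n : ℕ) (β : ℕ → ℚ) : Prop :=
  ((∀ i, i < n → ∃ z : ℤ, β i = (z : ℚ)) ∨
    (∀ i, i < n → ∃ z : ℤ, β i = (z : ℚ) + 1/2)) ∧
  (∀ i j, i ≤ j → j < n → β j ≤ β i) ∧ (∀ i, i < n → 0 ≤ β i) ∧ ∀ i, n ≤ i → β i = 0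

/-- `rank(β) = D_k(β₁,…,β_k) ⬝ B_{n-k}(β_{k+1},…,β_n)` on `OGr(k,2n+1)`. -/
def ogrOddRank (k n : ℕ) (β : ℕ → ℚ) : ℚ :=
  slDim k β * soOddDim (n - k) (fun i => β (k + i))

/-- `dex(β) = ((β₁+⋯+β_k)/k) ⬝ rank(β)` on `OGr(k,2n+1)`. -/
def ogrOddDex (k n : ℕ) (β : ℕ → ℚ) : ℚ := headSum k β / (k : ℚ) * ogrOddRank k n β

/-- A weight for the even orthogonal Grassmannian `OGr(k,2n)`:
`β₁ ≥ ⋯ ≥ β_{n-1} ≥ |β_n|`, all entries integers or all half-odd-integers,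
extended by zeros beyond position `n`. -/
def IsOGrEvenWeight (n : ℕ) (β : ℕ → ℚ) : Prop :=
  ((∀ i, i < n → ∃ z : ℤ, β i = (z : ℚ)) ∨
    (∀ i, i < n → ∃ z : ℤ, β i = (z : ℚ) + 1/2)) ∧
  (∀ i j, i ≤ j → j + 1 < n → β j ≤ β i) ∧
  (∀ i, i + 1 < n → |β (n - 1)| ≤ β i) ∧ ∀ i, n ≤ i → β i = 0

/-- `rank(β) = D_k(β₁,…,β_k) ⬝ E_{n-k}(β_{k+1},…,β_n)` on `OGr(k,2n)`. -/
def ogrEvenRank (k n : ℕ) (β : ℕ → ℚ) : ℚ :=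
  slDim k β * soEvenDim (n - k) (fun i => β (k + i))

/-- `dex(β) = ((β₁+⋯+β_k)/k) ⬝ rank(β)` on `OGr(k,2n)`. -/
def ogrEvenDex (k n : ℕ) (β : ℕ → ℚ) : ℚ := headSum k β / (k : ℚ) * ogrEvenRank k n β

/-- Replace the last entry `β_n` by its negative. -/
def negLast (n : ℕ) (β : ℕ → ℚ) : ℕ → ℚ := fun i => if i = n - 1 then -β i else β i

/-- The inner telescoping product in the dimension formula of a fundamental weight. -/
theorem prod_Ico_succ_sub_div (a k r : ℕ) (hak : a < k) (hkr : k ≤ r) :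
    ∏ b ∈ Finset.Ico k r, (((b : ℚ) - a + 1) / ((b : ℚ) - a)) = ((r : ℚ) - a) / ((k : ℚ) - a) := by
  have hk : (k : ℚ) - a ≠ 0 := sub_ne_zero.2 (by exact_mod_cast hak.ne')
  induction r, hkr using Nat.le_induction with
  | base => simp [div_self hk]
  | succ r hkr ih =>
    have hr : (r : ℚ) - a ≠ 0 := sub_ne_zero.2 (by exact_mod_cast (hak.trans_le hkr).ne')
    rw [Finset.prod_Ico_succ_top hkr, ih]
    push_cast
    field_simp
    ring

theorem cast_descFactorial_eq_prod_sub (k r : ℕ) (hkr : k ≤ r) :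
    ((r.descFactorial k : ℕ) : ℚ) = ∏ a ∈ Finset.range k, ((r : ℚ) - a) := by
  rw [Nat.descFactorial_eq_prod_range, Nat.cast_prod]
  refine Finset.prod_congr rfl fun a ha => ?_
  rw [Nat.cast_sub ((Finset.mem_range.1 ha).le.trans hkr)]

theorem prod_sub_div_sub_eq_choose (k r : ℕ) (hkr : k ≤ r) :
    ∏ a ∈ Finset.range k, (((r : ℚ) - a) / ((k : ℚ) - a)) = r.choose k := by
  rw [Finset.prod_div_distrib, ← cast_descFactorial_eq_prod_sub k r hkr,
    ← cast_descFactorial_eq_prod_sub k k le_rfl, Nat.descFactorial_self,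
    Nat.descFactorial_eq_factorial_mul_choose, Nat.cast_mul,
    mul_div_cancel_left₀ _ (by exact_mod_cast k.factorial_ne_zero)]

/-- The product over the positive roots `(a, b)` with `a < k ≤ b` evaluates
to a binomial coefficient. -/
theorem prod_range_ite_eq_choose (k r : ℕ) (hkr : k ≤ r) :
    ∏ a ∈ Finset.range r, ∏ b ∈ Finset.range r,
      (if a < k ∧ k ≤ b then ((b : ℚ) - a + 1) / ((b : ℚ) - a) else 1) = r.choose k := by
  rw [← prod_sub_div_sub_eq_choose k r hkr, ← Finset.prod_subset (Finset.range_mono hkr)]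
  · refine Finset.prod_congr rfl fun a ha => ?_
    rw [Finset.mem_range] at ha
    rw [← prod_Ico_succ_sub_div a k r ha hkr, ← Finset.prod_filter]
    refine Finset.prod_congr ?_ fun _ _ => rfl
    ext b
    simp only [Finset.mem_filter, Finset.mem_range, Finset.mem_Ico]
    tauto
  · intro a _ ha
    rw [Finset.mem_range] at ha
    simp [ha]

/-- If `r ≥ 2` and `β₁ ≥ ⋯ ≥ β_r ≥ 0` are integers with `β_i > β_{i+1}` for some
`1 ≤ i ≤ r−1`, then `D_r(β₁,…,β_r) ≥ (r choose i)`.  (Here `i` is the 1-indexed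
position; 0-indexed, the drop is between positions `i` and `i+1`.) -/
theorem stmt0 (r : ℕ) (hr : 2 ≤ r) (β : ℕ → ℤ)
    (hdec : ∀ i j, i ≤ j → j < r → β j ≤ β i)
    (hnn : ∀ i, i < r → 0 ≤ β i)
    (i : ℕ) (hi : i + 1 < r) (hlt : β (i + 1) < β i) :
    (r.choose (i + 1) : ℚ) ≤ slDim r (fun j => (β j : ℚ)) := by
  rw [← prod_range_ite_eq_choose (i + 1) r hi.le, slDim]
  have nonneg : ∀ a b : ℕ, (0 : ℚ) ≤
      if a < i + 1 ∧ i + 1 ≤ b then ((b : ℚ) - a + 1) / ((b : ℚ) - a) else 1 := by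
    intro a b
    split_ifs with h
    · have : (a : ℚ) < b := by exact_mod_cast h.1.trans_le h.2
      exact div_nonneg (by linarith) (by linarith)
    · exact zero_le_one
  refine Finset.prod_le_prod (fun a _ => Finset.prod_nonneg fun b _ => nonneg a b) fun a _ =>
    Finset.prod_le_prod (fun b _ => nonneg a b) fun b hb => ?_
  rw [Finset.mem_range] at hb
  by_cases hab : a < b
  · have hpos : (0 : ℚ) < (b : ℚ) - a := sub_pos.2 (by exact_mod_cast hab)
    rw [if_pos hab]
    split_ifs with h
    · have hdrop : β b + 1 ≤ β a := by
        have h₁ := hdec a i (by omega) (by omega)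
        have h₂ := hdec (i + 1) b h.2 hb
        omega
      have : (β b : ℚ) + 1 ≤ β a := by exact_mod_cast hdrop
      exact div_le_div_of_nonneg_right (by linarith) hpos.le
    · have : (β b : ℚ) ≤ β a := by exact_mod_cast hdec a b hab.le hb
      rw [le_div_iff₀ hpos]
      linarith
  · rw [if_neg hab, if_neg (by omega)]
end

section
/- Let n and k be integers with 2 ≤ k ≤ n−1 and let β be a weight for Gr(k,n). If β₁ > β_k and β_{k+1} > 0, then rank(β) ≥ k(n−k). -/
open Finset

/-- A sequence with `γ m < γ 0` strictly decreases at some step before `m`. -/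
theorem exists_step_lt (γ : ℕ → ℚ) (m : ℕ) (h : γ m < γ 0) :
    ∃ s < m, γ (s + 1) < γ s := by
  by_contra! hstep
  have hle : ∀ t ≤ m, γ 0 ≤ γ t := by
    intro t
    induction t with
    | zero => intro _; exact le_rfl
    | succ t ih => intro ht; exact (ih (by omega)).trans (hstep t (by omega))
  exact absurd (hle m le_rfl) (not_le.mpr h)

theorem prod_range_ratio_eq_sub (s d : ℕ) :
    ∏ j ∈ range (s + 1 + d),
      (if s < j then ((j : ℚ) - s + 1) / ((j : ℚ) - s) else 1) = d + 1 := by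
  induction d with
  | zero =>
    rw [Finset.prod_eq_one]
    · simp
    · intro j hj
      rw [if_neg (by have := mem_range.mp hj; omega)]
  | succ d ih =>
    rw [← add_assoc, prod_range_succ, ih, if_pos (by omega)]
    push_cast
    have h : (s : ℚ) + 1 + d - s ≠ 0 := by
      have : (0 : ℚ) ≤ d := d.cast_nonneg
      intro h
      linarith
    field_simp
    ring

theorem prod_range_ratio_eq_div (s t : ℕ) (ht : t ≤ s) :
    ∏ i ∈ range t, (((s : ℚ) + 1 - i + 1) / ((s : ℚ) + 1 - i)) =
      ((s : ℚ) + 2) / ((s : ℚ) + 2 - t) := by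
  have hts : ∀ u : ℕ, u ≤ s → (0 : ℚ) < (s : ℚ) + 1 - u := fun u hu => by
    have : (u : ℚ) ≤ s := by exact_mod_cast hu
    linarith
  induction t with
  | zero =>
    have : (s : ℚ) + 2 ≠ 0 := by positivity
    simp [this]
  | succ t ih =>
    rw [prod_range_succ, ih (by omega)]
    have h1 := hts t (by omega)
    have h2 : (s : ℚ) + 2 - t ≠ 0 := by linarith
    have h3 : (s : ℚ) + 2 - ((t + 1 : ℕ) : ℚ) = (s : ℚ) + 1 - t := by push_cast; ring
    have h4 : (s : ℚ) + 1 - t + 1 = (s : ℚ) + 2 - t := by ring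
    rw [h3, h4, div_mul_div_cancel₀ h2]

/-- A nontrivial irreducible representation of `sl(r)` has dimension at least `r`. -/
theorem le_slDim (r : ℕ) (γ : ℕ → ℚ) (hint : ∀ i, ∃ z : ℤ, γ i = (z : ℚ))
    (hanti : ∀ i j, i ≤ j → γ j ≤ γ i) (hlt : γ (r - 1) < γ 0) :
    (r : ℚ) ≤ slDim r γ := by
  obtain ⟨s, hs, hstep⟩ := exists_step_lt γ (r - 1) hlt
  have hgap : γ (s + 1) + 1 ≤ γ s := by
    obtain ⟨a, ha⟩ := hint s
    obtain ⟨b, hb⟩ := hint (s + 1)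
    rw [ha, hb] at hstep ⊢
    exact_mod_cast Int.add_one_le_iff.mpr (by exact_mod_cast hstep)
  set f : ℕ → ℕ → ℚ := fun i j =>
    if i < j then ((j : ℚ) - (i : ℚ) + γ i - γ j) / ((j : ℚ) - (i : ℚ)) else 1 with hf
  have hf_one : ∀ i j, 1 ≤ f i j := by
    intro i j
    simp only [hf]
    split_ifs with hij
    · have hpos : (0 : ℚ) < (j : ℚ) - i := sub_pos.mpr (by exact_mod_cast hij)
      rw [le_div_iff₀ hpos]
      linarith [hanti i j hij.le]
    · exact le_rfl
  have hf_jump : ∀ i j, i ≤ s → s < j →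
      ((j : ℚ) - i + 1) / ((j : ℚ) - i) ≤ f i j := by
    intro i j hi hj
    have hij : i < j := hi.trans_lt hj
    have hpos : (0 : ℚ) < (j : ℚ) - i := sub_pos.mpr (by exact_mod_cast hij)
    simp only [hf, if_pos hij]
    gcongr
    linarith [hanti i s hi, hanti (s + 1) j hj]
  have hrow_one : ∀ i, 1 ≤ ∏ j ∈ range r, f i j := fun i =>
    Finset.one_le_prod fun j _ => hf_one i j
  have hrow_lt : ∀ i ∈ range s,
      ((s : ℚ) + 1 - i + 1) / ((s : ℚ) + 1 - i) ≤ ∏ j ∈ range r, f i j := by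
    intro i hi
    have h := hf_jump i (s + 1) (mem_range.mp hi).le (by omega)
    push_cast at h
    refine h.trans ?_
    rw [← mul_prod_erase _ _ (mem_range.mpr (show s + 1 < r by omega))]
    exact le_mul_of_one_le_right (zero_le_one.trans (hf_one _ _))
      (Finset.one_le_prod fun j _ => hf_one i j)
  obtain ⟨d, rfl⟩ : ∃ d, r = s + 1 + d := ⟨r - (s + 1), by omega⟩
  have hd : (1 : ℚ) ≤ d := by exact_mod_cast (show 1 ≤ d by omega)
  have hrow_eq : (d : ℚ) + 1 ≤ ∏ j ∈ range (s + 1 + d), f s j := by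
    rw [← prod_range_ratio_eq_sub s d]
    refine prod_le_prod (fun j _ => ?_) fun j _ => ?_
    · split_ifs with hj
      · have : (0 : ℚ) < (j : ℚ) - s := sub_pos.mpr (by exact_mod_cast hj)
        positivity
      · exact zero_le_one
    · split_ifs with hj
      · exact hf_jump s j le_rfl hj
      · exact hf_one s j
  have hrows : ((s : ℚ) + 2) / 2 ≤ ∏ i ∈ range s, ∏ j ∈ range (s + 1 + d), f i j := by
    have h := prod_range_ratio_eq_div s s le_rfl
    rw [add_sub_cancel_left] at h
    rw [← h]
    refine prod_le_prod (fun i hi => ?_) hrow_lt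
    have : (i : ℚ) < s := by exact_mod_cast mem_range.mp hi
    exact div_nonneg (by linarith) (by linarith)
  have hs0 : (0 : ℚ) ≤ s := s.cast_nonneg
  calc ((s + 1 + d : ℕ) : ℚ) ≤ ((s : ℚ) + 2) / 2 * (d + 1) := by
        push_cast
        nlinarith [mul_nonneg hs0 (sub_nonneg.mpr hd)]
    _ ≤ (∏ i ∈ range s, ∏ j ∈ range (s + 1 + d), f i j) *
          ∏ j ∈ range (s + 1 + d), f s j :=
        mul_le_mul hrows hrow_eq (by positivity) (le_trans (by positivity) hrows)
    _ = ∏ i ∈ range (s + 1), ∏ j ∈ range (s + 1 + d), f i j := (prod_range_succ _ _).symm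
    _ ≤ (∏ i ∈ range (s + 1), ∏ j ∈ range (s + 1 + d), f i j) *
          ∏ i ∈ range d, ∏ j ∈ range (s + 1 + d), f (s + 1 + i) j :=
        le_mul_of_one_le_right
          (zero_le_one.trans (Finset.one_le_prod fun i _ => hrow_one i))
          (Finset.one_le_prod fun i _ => hrow_one _)
    _ = slDim (s + 1 + d) γ := (prod_range_add _ _ _).symm

/-- If `2 ≤ k ≤ n−1` and `β` is a weight for `Gr(k,n)` with `β₁ > β_k` and
`β_{k+1} > 0`, then `rank(β) ≥ k(n−k)`. -/
theorem stmt1 (n k : ℕ) (hk : 2 ≤ k) (hkn : k ≤ n - 1) (β : ℕ → ℚ)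
    (hβ : IsGrWeight n β) (h1 : β (k - 1) < β 0) (h2 : 0 < β k) :
    (k : ℚ) * ((n : ℚ) - (k : ℚ)) ≤ grRank k n β := by
  obtain ⟨hint, hanti, hzero⟩ := hβ
  have hhead := le_slDim k β hint hanti h1
  have htail := le_slDim (n - k) (fun i => β (k + i)) (fun i => hint _)
    (fun i j hij => hanti _ _ (by omega))
    (by
      rw [hzero (k + (n - k - 1)) (by omega)]
      exact h2)
  rw [Nat.cast_sub (by omega)] at htail
  have hnk : (k : ℚ) ≤ n := by exact_mod_cast (show k ≤ n by omega)
  exact mul_le_mul hhead htail (sub_nonneg.mpr hnk) (k.cast_nonneg.trans hhead)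
end

section
/- Let 1 ≤ k ≤ n−1 and let β¹, …, β^m be nonzero weights for Gr(k,n) such that rank(β¹) + … + rank(β^m) = k(n−k) − 4. Then every β^i satisfies β^i₁ = β^i₂ = … = β^i_k, or β^i_{k+1} = β^i_{k+2} = … = β^i_n = 0 (i.e. |β^i|₂ = 0). -/
open Finset

theorem slDim_succ (r : ℕ) (β : ℕ → ℚ) :
    slDim (r + 1) β =
      slDim r β * ∏ i ∈ range r, ((r : ℚ) - i + β i - β r) / ((r : ℚ) - i) := by
  unfold slDim
  have hlast : ∏ j ∈ range (r + 1),
      (if r < j then ((j : ℚ) - (r : ℚ) + β r - β j) / ((j : ℚ) - (r : ℚ)) else 1) = 1 :=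
    prod_eq_one fun j hj => if_neg (by have := mem_range.1 hj; omega)
  rw [prod_range_succ, hlast, mul_one, ← prod_mul_distrib]
  refine prod_congr rfl fun i hi => ?_
  rw [prod_range_succ, if_pos (mem_range.1 hi)]

theorem one_le_slDim_factor {β : ℕ → ℚ} (hβ : Antitone β) {i j : ℕ} (h : i < j) :
    1 ≤ ((j : ℚ) - i + β i - β j) / ((j : ℚ) - i) := by
  have hij : (i : ℚ) < j := by exact_mod_cast h
  rw [one_le_div (by linarith)]
  linarith [hβ h.le]

theorem one_le_slDim {β : ℕ → ℚ} (hβ : Antitone β) (r : ℕ) : 1 ≤ slDim r β := by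
  induction r with
  | zero => simp [slDim]
  | succ r ih =>
    rw [slDim_succ]
    exact one_le_mul_of_one_le_of_one_le ih
      (Finset.one_le_prod fun i hi => one_le_slDim_factor hβ (mem_range.1 hi))

theorem prod_range_succ_sub_div (r : ℕ) :
    ∏ i ∈ range r, ((r : ℚ) - i + 1) / ((r : ℚ) - i) = r + 1 := by
  induction r with
  | zero => simp
  | succ r ih =>
    rw [prod_range_succ']
    simp only [Nat.cast_add, Nat.cast_one, add_sub_add_right_eq_sub, ih, Nat.cast_zero, sub_zero]
    exact mul_div_cancel₀ _ (by positivity)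

/-- A nontrivial irreducible representation of `sl(r + 1)` has dimension at least `r + 1`. -/
theorem succ_le_slDim_succ {β : ℕ → ℚ} (hβ : Antitone β) (hint : ∀ i, ∃ z : ℤ, β i = z)
    (r : ℕ) (hr : β r < β 0) : (r : ℚ) + 1 ≤ slDim (r + 1) β := by
  have hfactor : ∀ i j, i < j → β j < β i →
      ((j : ℚ) - i + 1) / ((j : ℚ) - i) ≤ ((j : ℚ) - i + β i - β j) / ((j : ℚ) - i) := by
    intro i j hij h
    have hij' : (i : ℚ) < j := by exact_mod_cast hij
    have hgap : β j + 1 ≤ β i := by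
      obtain ⟨a, ha⟩ := hint i
      obtain ⟨b, hb⟩ := hint j
      rw [ha, hb] at h ⊢
      exact_mod_cast Int.add_one_le_iff.2 (by exact_mod_cast h)
    exact div_le_div_of_nonneg_right (by linarith) (by linarith)
  induction r with
  | zero => exact absurd hr (lt_irrefl _)
  | succ r ih =>
    rw [slDim_succ]
    rcases (hβ (Nat.zero_le r)).lt_or_eq with h | h
    · have hcol : ((r : ℚ) + 1 + 1) / (r + 1) ≤ ∏ i ∈ range (r + 1),
          (((r + 1 : ℕ) : ℚ) - i + β i - β (r + 1)) / (((r + 1 : ℕ) : ℚ) - i) := by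
        have h0 := hfactor 0 (r + 1) r.succ_pos hr
        simp only [Nat.cast_zero, sub_zero] at h0
        rw [prod_range_succ']
        push_cast at h0 ⊢
        simp only [sub_zero]
        refine h0.trans (le_mul_of_one_le_left ((by positivity : (0 : ℚ) ≤ _).trans h0) ?_)
        refine Finset.one_le_prod fun i hi => ?_
        exact_mod_cast one_le_slDim_factor hβ (Nat.succ_lt_succ (mem_range.1 hi))
      calc (((r + 1 : ℕ) : ℚ)) + 1 = (r + 1) * (((r : ℚ) + 1 + 1) / (r + 1)) := by
            push_cast; field_simp
        _ ≤ _ := mul_le_mul (ih h) hcol (by positivity)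
            (zero_le_one.trans (one_le_slDim hβ _))
    · have hcol : ((r + 1 : ℕ) : ℚ) + 1 ≤ ∏ i ∈ range (r + 1),
          (((r + 1 : ℕ) : ℚ) - i + β i - β (r + 1)) / (((r + 1 : ℕ) : ℚ) - i) := by
        rw [← prod_range_succ_sub_div]
        refine prod_le_prod (fun i hi => ?_) fun i hi => ?_
        · have : (i : ℚ) < (r + 1 : ℕ) := by exact_mod_cast mem_range.1 hi
          exact div_nonneg (by linarith) (by linarith)
        · have hi := mem_range.1 hi
          exact hfactor i (r + 1) hi (hr.trans_le (h ▸ hβ (Nat.le_of_lt_succ hi)))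
      exact hcol.trans (le_mul_of_one_le_left
        ((by positivity : (0 : ℚ) ≤ _).trans hcol) (one_le_slDim hβ _))

theorem le_slDim_s2 {β : ℕ → ℚ} (hβ : Antitone β) (hint : ∀ i, ∃ z : ℤ, β i = z)
    {r j : ℕ} (hj : j < r) (h : β j < β 0) : (r : ℚ) ≤ slDim r β := by
  obtain ⟨r, rfl⟩ := Nat.exists_eq_succ_of_ne_zero (Nat.ne_zero_of_lt hj)
  have := succ_le_slDim_succ hβ hint r ((hβ (Nat.le_of_lt_succ hj)).trans_lt h)
  exact_mod_cast this

theorem antitone_shift {β : ℕ → ℚ} (hβ : Antitone β) (k : ℕ) : Antitone fun i => β (k + i) :=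
  fun _ _ h => hβ (Nat.add_le_add_left h k)

theorem grRank_nonneg {β : ℕ → ℚ} (hβ : Antitone β) (k n : ℕ) : 0 ≤ grRank k n β :=
  mul_nonneg (zero_le_one.trans (one_le_slDim hβ _))
    (zero_le_one.trans (one_le_slDim (antitone_shift hβ k) _))

/-- If the ranks of nonzero weights `β¹,…,β^m` for `Gr(k,n)` add up to
`k(n−k) − 4`, then each `β^i` satisfies `β₁ = ⋯ = β_k` or `|β|₂ = 0`. -/
theorem stmt2 (n k : ℕ) (hk : 1 ≤ k) (hkn : k ≤ n - 1)
    (S : Multiset (ℕ → ℚ))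
    (hw : ∀ β ∈ S, IsGrWeight n β ∧ β ≠ 0)
    (hsum : (S.map (grRank k n)).sum = (k : ℚ) * ((n : ℚ) - (k : ℚ)) - 4) :
    ∀ β ∈ S, (∀ j, j < k → β j = β 0) ∨ ∀ j, k ≤ j → β j = 0 := by
  intro β hβ
  obtain ⟨⟨hint, hanti, hzero⟩, -⟩ := hw β hβ
  by_contra! hcon
  obtain ⟨⟨a, hak, ha⟩, b, hkb, hb⟩ := hcon
  have hanti' : Antitone β := hanti
  have hbn : b < n - 1 := by
    by_contra! h
    exact hb (hzero b h)
  have hhead : (k : ℚ) ≤ slDim k β :=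
    le_slDim_s2 hanti' hint hak (lt_of_le_of_ne (hanti 0 a a.zero_le) ha)
  have htail : ((n - k : ℕ) : ℚ) ≤ slDim (n - k) fun i => β (k + i) := by
    refine le_slDim_s2 (antitone_shift hanti' k) (fun i => hint (k + i))
      (show n - 1 - k < n - k by omega) ?_
    have hlast : β (k + (n - 1 - k)) = 0 := hzero _ (by omega)
    have hbpos : 0 < β b :=
      lt_of_le_of_ne ((hzero (n - 1) le_rfl) ▸ hanti b (n - 1) hbn.le) hb.symm
    simpa [hlast] using hbpos.trans_le (hanti k b hkb)
  have hrank : (k : ℚ) * ((n - k : ℕ) : ℚ) ≤ grRank k n β :=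
    mul_le_mul hhead htail (Nat.cast_nonneg _) ((Nat.cast_nonneg k).trans hhead)
  have hle : grRank k n β ≤ (S.map (grRank k n)).sum := by
    refine Multiset.single_le_sum (fun x hx => ?_) _ (Multiset.mem_map_of_mem _ hβ)
    obtain ⟨γ, hγ, rfl⟩ := Multiset.mem_map.1 hx
    exact grRank_nonneg (hw γ hγ).1.2.1 k n
  rw [Nat.cast_sub (by omega)] at hrank
  linarith
end

section
/- (Reduction of cases.) Let k and n be integers with k ≥ 4 and n − k ≥ 4, and let β be a nonzero weight for Gr(k,n) with β ≠ (1,0,…,0) and rank(β)·(|β|₁ − 1) ≤ k² + 4. Then one of the following holds: (i) β₁ = β₂ = … = β_k; (ii) β = (1,…,1,0,…,0) with k−1 leading ones followed by zeros; (iii) β = (1,1,0,…,0); (iv) β = (2,0,…,0); (v) β = (2,1,…,1,0,…,0), namely a 2 followed by k−1 ones followed by n−k zeros; (vi) β = (1,1,1,0,…,0) and k ∈ {5,6}. -/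
open Finset

theorem choose_le_choose_of_le_of_add_le {N a d : ℕ} (had : a ≤ d) (hd : d + a ≤ N) :
    N.choose a ≤ N.choose d := by
  have half : ∀ e, a ≤ e → 2 * e ≤ N → N.choose a ≤ N.choose e := by
    intro e hae
    induction e, hae using Nat.le_induction with
    | base => intro _; exact le_rfl
    | succ e _ ih =>
      intro he
      exact (ih (by omega)).trans (Nat.choose_le_succ_of_lt_half_left (by omega))
  rcases le_total (2 * d) N with h | h
  · exact half d had h
  · rw [← Nat.choose_symm (show d ≤ N by omega)]
    exact half (N - d) (by omega) (by omega)

/-- The product of the shifted hook factors over the box `[0, d) × [d, r)`. -/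
def boxProd (r s d : ℕ) : ℚ :=
  ∏ i ∈ range r, ∏ j ∈ range r,
    if i < d ∧ d ≤ j then ((j : ℚ) - i + s + 1) / ((j : ℚ) - i + s) else 1

theorem prod_range_telescope {i d r : ℕ} (s : ℕ) (hid : i < d) (hdr : d ≤ r) :
    (∏ j ∈ range r, if d ≤ j then ((j : ℚ) - i + s + 1) / ((j : ℚ) - i + s) else 1) =
      ((r : ℚ) - i + s) / ((d : ℚ) - i + s) := by
  have hi : (i : ℚ) + 1 ≤ d := by exact_mod_cast hid
  have hs : (0 : ℚ) ≤ s := s.cast_nonneg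
  induction r, hdr using Nat.le_induction with
  | base =>
    rw [div_self (by linarith)]
    refine Finset.prod_eq_one fun j hj => if_neg ?_
    have := Finset.mem_range.1 hj
    omega
  | succ r hdr ih =>
    have hr : (d : ℚ) ≤ r := by exact_mod_cast hdr
    have h1 : (r : ℚ) - i + s ≠ 0 := by linarith
    have h2 : (d : ℚ) - i + s ≠ 0 := by linarith
    rw [Finset.prod_range_succ, ih, if_pos hdr]
    push_cast
    field_simp
    ring

theorem prod_range_sub_eq_descFactorial {N d : ℕ} (h : d ≤ N) :
    ∏ i ∈ range d, ((N : ℚ) - i) = N.descFactorial d := by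
  rw [Nat.descFactorial_eq_prod_range, Nat.cast_prod]
  refine Finset.prod_congr rfl fun i hi => ?_
  rw [Nat.cast_sub (by have := Finset.mem_range.1 hi; omega)]

theorem boxProd_eq {r d : ℕ} (s : ℕ) (hdr : d ≤ r) :
    boxProd r s d = ((r + s).choose d : ℚ) / (d + s).choose d := by
  have h1 : boxProd r s d = ∏ i ∈ range r,
      if i < d then ((r : ℚ) - i + s) / ((d : ℚ) - i + s) else 1 := by
    refine Finset.prod_congr rfl fun i _ => ?_
    by_cases hi : i < d
    · simp only [hi, true_and, if_true]
      exact prod_range_telescope s hi hdr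
    · simp [hi]
  have h2 : (range r).filter (· < d) = range d := by
    ext i
    simp only [Finset.mem_filter, Finset.mem_range]
    omega
  have h3 : (d.factorial : ℚ) ≠ 0 := by exact_mod_cast d.factorial_ne_zero
  have h4 : ((d + s).choose d : ℚ) ≠ 0 := by
    exact_mod_cast (Nat.choose_pos (by omega)).ne'
  rw [h1, ← Finset.prod_filter, h2, Finset.prod_div_distrib]
  have h5 : ∀ M : ℕ, ∀ _ : d ≤ M, ∏ i ∈ range d, ((M : ℚ) - i + s) =
      d.factorial * (M + s).choose d := by
    intro M hM
    rw [← Nat.cast_mul, ← Nat.descFactorial_eq_factorial_mul_choose,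
      ← prod_range_sub_eq_descFactorial (by omega)]
    refine Finset.prod_congr rfl fun i _ => ?_
    push_cast
    ring
  rw [h5 r hdr, h5 d le_rfl, mul_div_mul_left _ _ h3]

theorem boxProd_zero {r d : ℕ} (hdr : d ≤ r) : boxProd r 0 d = r.choose d := by
  simp [boxProd_eq 0 hdr]

theorem half_le_boxProd_one {r d : ℕ} (hd : 1 ≤ d) (hdr : d < r) :
    ((r : ℚ) + 1) / 2 ≤ boxProd r 1 d := by
  rw [boxProd_eq 1 hdr.le]
  have h1 : (r + 2) * (r + 1).choose d = (r + 2).choose (d + 1) * (d + 1) :=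
    Nat.add_one_mul_choose_eq (r + 1) d
  have h2 : (r + 2).choose 2 ≤ (r + 2).choose (d + 1) :=
    choose_le_choose_of_le_of_add_le (by omega) (by omega)
  have h1' : ((r : ℚ) + 2) * (r + 1).choose d = (r + 2).choose (d + 1) * (d + 1) := by
    exact_mod_cast h1
  have h2' : ((r + 2).choose 2 : ℚ) ≤ (r + 2).choose (d + 1) := by exact_mod_cast h2
  rw [Nat.cast_choose_two] at h2'
  push_cast at h2'
  have h3 : ((d + 1).choose d : ℚ) = d + 1 := by simp
  rw [h3, le_div_iff₀ (by positivity)]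
  have hr : (0 : ℚ) < r + 2 := by positivity
  refine le_of_mul_le_mul_left ?_ hr
  rw [h1']
  have hd' : (0 : ℚ) ≤ d + 1 := by positivity
  nlinarith [mul_le_mul_of_nonneg_right h2' hd']

theorem boxProd_zero_le_slDim {r d : ℕ} {b : ℕ → ℕ} (hb : ∀ i j, i ≤ j → b j ≤ b i)
    (hgap : ∀ i j, i < d → d ≤ j → j < r → b j + 1 ≤ b i) :
    boxProd r 0 d ≤ slDim r (fun i => b i) := by
  have hle : ∀ i ∈ range r, ∀ j ∈ range r,
      0 ≤ (if i < d ∧ d ≤ j then ((j : ℚ) - i + (0 : ℕ) + 1) / ((j : ℚ) - i + (0 : ℕ)) else 1) ∧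
      (if i < d ∧ d ≤ j then ((j : ℚ) - i + (0 : ℕ) + 1) / ((j : ℚ) - i + (0 : ℕ)) else 1) ≤
        if i < j then ((j : ℚ) - i + b i - b j) / ((j : ℚ) - i) else 1 := by
    intro i _ j hj
    by_cases hij : i < j
    · have hx : (0 : ℚ) < (j : ℚ) - i := by
        rw [sub_pos]; exact_mod_cast hij
      rw [if_pos hij]
      split_ifs with h
      · have hg : (b j : ℚ) + 1 ≤ b i := by
          exact_mod_cast hgap i j h.1 h.2 (Finset.mem_range.1 hj)
        simp only [Nat.cast_zero, add_zero]
        exact ⟨by positivity, by gcongr; linarith⟩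
      · have hg : (b j : ℚ) ≤ b i := by exact_mod_cast hb i j hij.le
        refine ⟨zero_le_one, ?_⟩
        rw [le_div_iff₀ hx]
        linarith
    · rw [if_neg hij, if_neg (by omega)]
      exact ⟨zero_le_one, le_rfl⟩
  exact Finset.prod_le_prod
    (fun i hi => Finset.prod_nonneg fun j hj => (hle i hi j hj).1)
    fun i hi => Finset.prod_le_prod (fun j hj => (hle i hi j hj).1) fun j hj => (hle i hi j hj).2

theorem choose_le_slDim {r d : ℕ} {b : ℕ → ℕ} (hb : ∀ i j, i ≤ j → b j ≤ b i) (hdr : d ≤ r)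
    (hgap : ∀ i j, i < d → d ≤ j → j < r → b j + 1 ≤ b i) :
    (r.choose d : ℚ) ≤ slDim r (fun i => b i) :=
  boxProd_zero hdr ▸ boxProd_zero_le_slDim hb hgap

theorem one_le_slDim_s3 {b : ℕ → ℕ} (r : ℕ) (hb : ∀ i j, i ≤ j → b j ≤ b i) :
    1 ≤ slDim r (fun i => b i) := by
  simpa using choose_le_slDim (r := r) (d := 0) hb (Nat.zero_le _) (by omega)

theorem boxProd_mul_boxProd_le_slDim {r d e : ℕ} {b : ℕ → ℕ}
    (hgap : ∀ i j, i < j → j < r →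
      b j + (if i < d ∧ d ≤ j then 1 else 0) + (if i < e ∧ e ≤ j then 1 else 0) ≤ b i) :
    boxProd r 0 d * boxProd r 1 e ≤ slDim r (fun i => b i) := by
  simp only [boxProd, ← Finset.prod_mul_distrib]
  have hle : ∀ i ∈ range r, ∀ j ∈ range r,
      0 ≤ (if i < d ∧ d ≤ j then ((j : ℚ) - i + (0 : ℕ) + 1) / ((j : ℚ) - i + (0 : ℕ)) else 1) *
        (if i < e ∧ e ≤ j then ((j : ℚ) - i + (1 : ℕ) + 1) / ((j : ℚ) - i + (1 : ℕ)) else 1) ∧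
      (if i < d ∧ d ≤ j then ((j : ℚ) - i + (0 : ℕ) + 1) / ((j : ℚ) - i + (0 : ℕ)) else 1) *
        (if i < e ∧ e ≤ j then ((j : ℚ) - i + (1 : ℕ) + 1) / ((j : ℚ) - i + (1 : ℕ)) else 1) ≤
        if i < j then ((j : ℚ) - i + b i - b j) / ((j : ℚ) - i) else 1 := by
    intro i _ j hj
    by_cases hij : i < j
    · have hx : (0 : ℚ) < (j : ℚ) - i := by
        rw [sub_pos]; exact_mod_cast hij
      have hg := hgap i j hij (Finset.mem_range.1 hj)
      rw [if_pos hij]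
      generalize (j : ℚ) - i = x at hx
      simp only [Nat.cast_zero, add_zero, Nat.cast_one]
      refine ⟨by split_ifs <;> positivity, ?_⟩
      rw [le_div_iff₀ hx]
      split_ifs at hg ⊢
      · have hg' : (b j : ℚ) + 1 + 1 ≤ b i := by exact_mod_cast hg
        field_simp
        linarith
      · have hg' : (b j : ℚ) + 1 ≤ b i := by exact_mod_cast hg
        field_simp
        linarith
      · have hg' : (b j : ℚ) + 1 ≤ b i := by exact_mod_cast hg
        rw [one_mul, div_mul_eq_mul_div, div_le_iff₀ (by linarith)]
        nlinarith
      · have hg' : (b j : ℚ) ≤ b i := by exact_mod_cast hg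
        linarith
    · rw [if_neg hij, if_neg (by omega), if_neg (by omega)]
      norm_num
  exact Finset.prod_le_prod
    (fun i hi => Finset.prod_nonneg fun j hj => (hle i hi j hj).1)
    fun i hi => Finset.prod_le_prod (fun j hj => (hle i hi j hj).1) fun j hj => (hle i hi j hj).2

/-- The first and the last descent of a non-constant antitone sequence on `[0, r)`. -/
theorem exists_first_last_descent {r : ℕ} {b : ℕ → ℕ} (hb : ∀ i j, i ≤ j → b j ≤ b i)
    (hr : 1 ≤ r) (hne : b (r - 1) < b 0) :
    ∃ d e, 1 ≤ d ∧ d ≤ e ∧ e < r ∧ (∀ i, i < d → b i = b 0) ∧ (∀ i, d ≤ i → b i < b 0) ∧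
      (∀ i, i < e → b (r - 1) < b i) ∧ (∀ i, e ≤ i → i < r → b i = b (r - 1)) := by
  classical
  have hd : ∃ d, b d < b 0 := ⟨_, hne⟩
  have he : ∃ e, b e ≤ b (r - 1) := ⟨_, le_rfl⟩
  refine ⟨Nat.find hd, Nat.find he, ?_, ?_, ?_, ?_, ?_, ?_, ?_⟩
  · rw [Nat.one_le_iff_ne_zero]
    intro h
    have := Nat.find_spec hd
    rw [h] at this
    exact this.false
  · exact Nat.find_min' hd ((Nat.find_spec he).trans_lt hne)
  · have := Nat.find_min' he (le_refl (b (r - 1)))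
    omega
  · intro i hi
    exact le_antisymm (hb 0 i (Nat.zero_le _)) (not_lt.1 (Nat.find_min hd hi))
  · intro i hi
    exact (hb _ _ hi).trans_lt (Nat.find_spec hd)
  · intro i hi
    exact not_le.1 (Nat.find_min he hi)
  · intro i hi hir
    exact le_antisymm ((hb _ _ hi).trans (Nat.find_spec he)) (hb _ _ (by omega))

theorem le_slDim_of_lt {r : ℕ} {b : ℕ → ℕ} (hb : ∀ i j, i ≤ j → b j ≤ b i)
    (hr : 1 ≤ r) (hne : b (r - 1) < b 0) : (r : ℚ) ≤ slDim r (fun i => b i) := by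
  obtain ⟨d, e, hd, hde, her, h1, h2, -, -⟩ := exists_first_last_descent hb hr hne
  refine le_trans ?_ (choose_le_slDim (d := d) hb (by omega) ?_)
  · have : r.choose 1 ≤ r.choose d := choose_le_choose_of_le_of_add_le hd (by omega)
    rw [Nat.choose_one_right] at this
    exact_mod_cast this
  · intro i j hi hj _
    rw [h1 i hi]
    exact h2 j hj

theorem mul_half_le_slDim_of_add_two_le {r : ℕ} {b : ℕ → ℕ} (hb : ∀ i j, i ≤ j → b j ≤ b i)
    (hr : 1 ≤ r) (hne : b (r - 1) + 2 ≤ b 0) :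
    (r : ℚ) * ((r + 1) / 2) ≤ slDim r (fun i => b i) := by
  obtain ⟨d, e, hd, hde, her, h1, h2, h3, h4⟩ :=
    exists_first_last_descent hb hr (by omega)
  refine le_trans ?_ (boxProd_mul_boxProd_le_slDim (d := d) (e := e) ?_)
  · rw [boxProd_zero (by omega)]
    have : r.choose 1 ≤ r.choose d := choose_le_choose_of_le_of_add_le hd (by omega)
    rw [Nat.choose_one_right] at this
    have h : (r : ℚ) ≤ r.choose d := by exact_mod_cast this
    exact mul_le_mul h (half_le_boxProd_one (by omega) her) (by positivity) (by positivity)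
  · intro i j hij hj
    have hbij := hb i j hij.le
    split_ifs with hi hi' hi'
    · rw [h1 i hi.1, h4 j hi'.2 hj]
      omega
    · rw [h1 i hi.1]
      exact h2 j hi.2
    · rw [h4 j hi'.2 hj]
      exact h3 i hi'.1
    · exact hbij

theorem lw_replicate_one (m i : ℕ) :
    lw (List.replicate m 1) i = if i < m then 1 else 0 := by
  simp only [lw, List.getD_eq_getElem?_getD, List.getElem?_replicate]
  split_ifs <;> rfl

theorem add_mul_le_sum_range {k : ℕ} {b : ℕ → ℕ} (hb : ∀ i j, i ≤ j → b j ≤ b i) (hk : 1 ≤ k) :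
    b 0 + (k - 1) * b (k - 1) ≤ ∑ i ∈ range k, b i := by
  obtain ⟨m, rfl⟩ : ∃ m, k = m + 1 := ⟨k - 1, by omega⟩
  rw [Finset.sum_range_succ', add_comm, Nat.add_sub_cancel]
  refine Nat.add_le_add_right ?_ _
  have := Finset.card_nsmul_le_sum (range m) (fun i => b (i + 1)) (b m)
    fun i hi => hb _ _ (by have := Finset.mem_range.1 hi; omega)
  simpa using this

theorem sum_range_of_step {k d c : ℕ} {b : ℕ → ℕ} (hd : d ≤ k)
    (h1 : ∀ i, i < d → b i = c + 1) (h2 : ∀ i, d ≤ i → i < k → b i = c) :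
    ∑ i ∈ range k, b i = k * c + d := by
  have h : ∀ i ∈ range k, b i = c + if i < d then 1 else 0 := by
    intro i hi
    split_ifs with hid
    · exact h1 i hid
    · exact h2 i (not_lt.1 hid) (Finset.mem_range.1 hi)
  have h3 : (range k).filter (· < d) = range d := by
    ext i
    simp only [Finset.mem_filter, Finset.mem_range]
    omega
  rw [Finset.sum_congr rfl h, Finset.sum_add_distrib, Finset.sum_boole, h3]
  simp

theorem fifteen_le_slDim_four {b : ℕ → ℕ} (hb : ∀ i j, i ≤ j → b j ≤ b i) (h0 : 2 ≤ b 0)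
    (h3 : b 3 = 0) (hS : b 0 + b 1 + b 2 = 3) : 15 ≤ slDim 4 (fun i => b i) := by
  have h12 := hb 1 2 (by norm_num)
  have h2 : b 2 = 0 := by omega
  have h : b 0 = 3 ∧ b 1 = 0 ∨ b 0 = 2 ∧ b 1 = 1 := by omega
  rcases h with ⟨h0, h1⟩ | ⟨h0, h1⟩ <;>
    norm_num [slDim, Finset.prod_range_succ, h0, h1, h2, h3]

/-- The `d`-th exterior power of the standard representation satisfies the rank bound only for
small or extremal `d`. -/
theorem exterior_cases {k d : ℕ} (hk : 4 ≤ k) (hd : 2 ≤ d) (hdk : d < k)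
    (h : (k.choose d : ℚ) * (d - 1) ≤ (k : ℚ) ^ 2 + 4) :
    d = 2 ∨ d = k - 1 ∨ d = 3 ∧ (k = 5 ∨ k = 6) := by
  by_contra! hcon
  obtain ⟨h2, h1, h3⟩ := hcon
  have hd3 : (3 : ℚ) ≤ d := by exact_mod_cast (show 3 ≤ d by omega)
  have hc0 : (0 : ℚ) ≤ k.choose d := by positivity
  rcases Nat.lt_or_ge (d + 2) k with hlt | hge
  · have hc : k.choose 3 ≤ k.choose d := choose_le_choose_of_le_of_add_le (by omega) (by omega)
    obtain ⟨m, rfl⟩ : ∃ m, k = m + 6 := ⟨k - 6, by omega⟩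
    rcases Nat.eq_zero_or_pos m with rfl | hm
    · exact (h3 (by omega)).2 rfl
    have h6 : (m + 6) * ((m + 5) * (m + 4)) = 6 * (m + 6).choose 3 := by
      have := Nat.descFactorial_eq_factorial_mul_choose (m + 6) 3
      simp [Nat.descFactorial, Nat.factorial] at this
      linarith
    have h6' : ((m : ℚ) + 6) * ((m + 5) * (m + 4)) = 6 * (m + 6).choose 3 := by exact_mod_cast h6
    have hc' : ((m + 6).choose 3 : ℚ) ≤ (m + 6).choose d := by exact_mod_cast hc
    have hm' : (1 : ℚ) ≤ m := by exact_mod_cast hm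
    push_cast at h
    nlinarith [mul_le_mul_of_nonneg_left hd3 hc0, pow_pos (by linarith : (0 : ℚ) < m) 3]
  · obtain rfl : k = d + 2 := by omega
    have hd4 : (4 : ℚ) ≤ d := by exact_mod_cast (show 4 ≤ d by omega)
    have hc : ((d + 2).choose d : ℚ) = ((d : ℚ) + 2) * (d + 1) / 2 := by
      rw [← Nat.choose_symm (by omega), Nat.add_sub_cancel_left, Nat.cast_choose_two]
      push_cast
      ring
    rw [hc] at h
    push_cast at h
    nlinarith [mul_nonneg (sub_nonneg.2 hd4) (sub_nonneg.2 hd4),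
      mul_nonneg (mul_nonneg (sub_nonneg.2 hd4) (sub_nonneg.2 hd4)) (sub_nonneg.2 hd4)]

theorem IsGrWeight.exists_nat {n : ℕ} {β : ℕ → ℚ} (hβ : IsGrWeight n β) :
    ∃ b : ℕ → ℕ, β = (fun i => (b i : ℚ)) ∧ (∀ i j, i ≤ j → b j ≤ b i) ∧
      ∀ i, n - 1 ≤ i → b i = 0 := by
  obtain ⟨hinteger, hanti, hzero⟩ := hβ
  have hnat : ∀ i, ∃ m : ℕ, β i = m := by
    intro i
    obtain ⟨z, hz⟩ := hinteger i
    have h0 : 0 ≤ β i := by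
      rw [← hzero (max i (n - 1)) (le_max_right _ _)]
      exact hanti _ _ (le_max_left _ _)
    have hz0 : 0 ≤ z := by
      rw [hz] at h0
      exact_mod_cast h0
    lift z to ℕ using hz0
    exact ⟨z, by simpa using hz⟩
  choose b hb using hnat
  refine ⟨b, funext hb, fun i j hij => ?_, fun i hi => ?_⟩
  · have := hanti i j hij
    rw [hb, hb] at this
    exact_mod_cast this
  · have := hzero i hi
    rw [hb] at this
    exact_mod_cast this

/-- Reduction of cases: for `k, n−k ≥ 4` and a nonzero weight `β ≠ (1,0,…,0)` for
`Gr(k,n)` with `rank(β)(|β|₁ − 1) ≤ k² + 4`, the weight `β` is one of the types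
(A), (B), (C), (Z), (D), or `(1,1,1,0,…,0)` with `k ∈ {5,6}`. -/
theorem stmt3 (k n : ℕ) (hk : 4 ≤ k) (hnk : 4 ≤ n - k) (β : ℕ → ℚ)
    (hβ : IsGrWeight n β) (hnz : β ≠ 0) (hne : β ≠ lw [1])
    (hineq : grRank k n β * (headSum k β - 1) ≤ (k : ℚ) ^ 2 + 4) :
    (∀ j, j < k → β j = β 0) ∨
    β = lw (List.replicate (k - 1) 1) ∨
    β = lw [1, 1] ∨
    β = lw [2] ∨
    β = lw (2 :: List.replicate (k - 1) 1) ∨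
    (β = lw [1, 1, 1] ∧ (k = 5 ∨ k = 6)) := by
  obtain ⟨b, rfl, hb, hb0⟩ := hβ.exists_nat
  by_cases hconst : b (k - 1) = b 0
  · refine Or.inl fun j hj => ?_
    have h1 := hb 0 j (Nat.zero_le _)
    have h2 := hb j (k - 1) (by omega)
    simp only [Nat.cast_inj]
    omega
  right
  have hlt : b (k - 1) < b 0 := lt_of_le_of_ne (hb _ _ (Nat.zero_le _)) hconst
  have hSlow := add_mul_le_sum_range hb (show 1 ≤ k by omega)
  have hSeq : headSum k (fun i => (b i : ℚ)) = ((∑ i ∈ range k, b i : ℕ) : ℚ) := by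
    simp [headSum]
  rw [hSeq, grRank] at hineq
  set S := ∑ i ∈ range k, b i with hSdef
  have hbt : ∀ i j, i ≤ j → b (k + j) ≤ b (k + i) := fun i j hij => hb _ _ (by omega)
  have hD := le_slDim_of_lt hb (show 1 ≤ k by omega) hlt
  have hT := one_le_slDim_s3 (b := fun i => b (k + i)) (n - k) hbt
  set D := slDim k (fun i => (b i : ℚ))
  have hk4 : (4 : ℚ) ≤ k := by exact_mod_cast hk
  have hS1 : 1 ≤ S := by omega
  have hS1' : (1 : ℚ) ≤ S := by exact_mod_cast hS1
  have hck : b (k - 1) * k + 1 ≤ S := by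
    have : (k - 1) * b (k - 1) + b (k - 1) = b (k - 1) * k := by
      conv_rhs => rw [show k = (k - 1) + 1 by omega]
      simp
      ring
    omega
  have htail : b k = 0 := by
    by_contra hbk
    have hT' := le_slDim_of_lt (b := fun i => b (k + i)) hbt (show 1 ≤ n - k by omega)
      (by
        have := hb0 (k + (n - k - 1)) (by omega)
        simp only [this]
        simpa using Nat.pos_of_ne_zero hbk)
    have hc : 1 ≤ b (k - 1) := (Nat.pos_of_ne_zero hbk).trans_le (hb _ _ (by omega))
    have hkS : (k : ℚ) + 1 ≤ S := by exact_mod_cast (show k + 1 ≤ S by nlinarith)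
    have h4 : (4 : ℚ) ≤ ((n - k : ℕ) : ℚ) := by exact_mod_cast hnk
    have h5 : (k : ℚ) * 4 ≤ D * slDim (n - k) (fun i => (b (k + i) : ℚ)) :=
      mul_le_mul hD (h4.trans hT') (by norm_num) (by linarith)
    have h6 := mul_le_mul h5 (show (k : ℚ) ≤ S - 1 by linarith) (by linarith) (by linarith)
    nlinarith
  have hDS : D * ((S : ℚ) - 1) ≤ (k : ℚ) ^ 2 + 4 := by
    refine le_trans ?_ hineq
    refine mul_le_mul_of_nonneg_right ?_ (by linarith)
    exact le_mul_of_one_le_right (by linarith) hT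
  have hzero : ∀ i, k ≤ i → b i = 0 := fun i hi => Nat.eq_zero_of_le_zero (htail ▸ hb k i hi)
  have hc1 : b (k - 1) ≤ 1 := by
    by_contra! hc
    have hkS : 2 * (k : ℚ) + 1 ≤ S := by exact_mod_cast (show 2 * k + 1 ≤ S by nlinarith)
    have h6 := mul_le_mul hD (show 2 * (k : ℚ) ≤ S - 1 by linarith) (by linarith) (by linarith)
    nlinarith
  by_cases hgap : b (k - 1) + 2 ≤ b 0
  · have hD2 := mul_half_le_slDim_of_add_two_le hb (show 1 ≤ k by omega) hgap
    have hDS2 : (k : ℚ) * ((k + 1) / 2) * (S - 1) ≤ (k : ℚ) ^ 2 + 4 :=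
      (mul_le_mul_of_nonneg_right hD2 (by linarith)).trans hDS
    have hS3 : S ≤ 3 := by
      by_contra! hS
      have : (4 : ℚ) ≤ S := by exact_mod_cast hS
      have h6 := mul_le_mul_of_nonneg_left (show (3 : ℚ) ≤ S - 1 by linarith)
        (show (0 : ℚ) ≤ k * ((k + 1) / 2) by positivity)
      nlinarith
    have hc0 : b (k - 1) = 0 := by
      by_contra hc
      have := Nat.le_mul_of_pos_left k (Nat.pos_of_ne_zero hc)
      omega
    have hS2 : S = 2 := by
      by_contra hS
      have hS' : S = 3 := by omega
      have hSq : (S : ℚ) = 3 := by exact_mod_cast hS'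
      rw [hSq] at hDS2 hDS
      have hk' : k = 4 := by
        have : (k : ℚ) < 5 := by nlinarith
        have : k < 5 := by exact_mod_cast this
        omega
      subst hk'
      have h15 : 15 ≤ D := fifteen_le_slDim_four hb (by omega) hc0 (by
        rw [hS'] at hSdef
        simp only [Finset.sum_range_succ, Finset.sum_range_zero] at hSdef
        have : b 3 = 0 := hc0
        omega)
      norm_num at hDS
      linarith
    refine Or.inr (Or.inr (Or.inl ?_))
    have h1 : ∀ i, 1 ≤ i → b i = 0 := by
      intro i hi
      refine Nat.eq_zero_of_le_zero ((hb 1 i hi).trans ?_)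
      have : ∑ i ∈ range 2, b i ≤ S :=
        Finset.sum_le_sum_of_subset (Finset.range_mono (by omega))
      simp only [Finset.sum_range_succ, Finset.sum_range_zero] at this
      omega
    have h0 : b 0 = 2 := by
      have := Finset.single_le_sum (f := b) (fun i _ => Nat.zero_le _)
        (Finset.mem_range.2 (show 0 < k by omega))
      omega
    funext i
    rcases i with _ | i
    · simp [lw, h0]
    · simp [lw, h1 (i + 1) (by omega)]
  · obtain ⟨d, e, hd, hde, hek, h1, h2, -, -⟩ :=
      exists_first_last_descent hb (show 1 ≤ k by omega) hlt
    have hone : ∀ i, i < d → b i = b (k - 1) + 1 := by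
      intro i hi
      rw [h1 i hi]
      omega
    have hbot : ∀ i, d ≤ i → i < k → b i = b (k - 1) := by
      intro i hi hik
      have := h2 i hi
      have := hb i (k - 1) (by omega)
      omega
    have hS : S = k * b (k - 1) + d := sum_range_of_step (by omega) hone hbot
    have hDd : (k.choose d : ℚ) ≤ D := by
      refine choose_le_slDim hb (by omega) fun i j hi hj _ => ?_
      rw [h1 i hi]
      exact h2 j hj
    have hDS2 : (k.choose d : ℚ) * (S - 1) ≤ (k : ℚ) ^ 2 + 4 :=
      (mul_le_mul_of_nonneg_right hDd (by linarith)).trans hDS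
    rcases Nat.le_one_iff_eq_zero_or_eq_one.1 hc1 with hc | hc
    · rw [hc] at hone hbot hS
      have hval : ∀ i, (b i : ℚ) = if i < d then 1 else 0 := by
        intro i
        split_ifs with hi
        · simp [hone i hi]
        · rcases Nat.lt_or_ge i k with hik | hik
          · simp [hbot i (not_lt.1 hi) hik]
          · simp [hzero i hik]
      have hrep : (fun i => (b i : ℚ)) = lw (List.replicate d 1) := by
        funext i
        rw [hval, lw_replicate_one]
      have hd2 : 2 ≤ d := by
        by_contra! hd2
        obtain rfl : d = 1 := by omega
        exact hne hrep
      rw [mul_zero, zero_add] at hS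
      rw [hS] at hDS2
      rcases exterior_cases hk hd2 (by omega) hDS2 with rfl | rfl | ⟨rfl, hk'⟩
      · exact Or.inr (Or.inl hrep)
      · exact Or.inl hrep
      · exact Or.inr (Or.inr (Or.inr (Or.inr ⟨hrep, hk'⟩)))
    · rw [hc] at hone hbot hS
      have hSq : (S : ℚ) = k + d := by rw [hS]; push_cast; ring
      have hd1 : d = 1 := by
        by_contra hd1
        have hd2 : (2 : ℚ) ≤ d := by exact_mod_cast (show 2 ≤ d by omega)
        rw [hSq] at hDS hDS2
        have hk' : k = 4 := by
          have : (k : ℚ) < 5 := by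
            have := mul_le_mul_of_nonneg_right hD (show (0 : ℚ) ≤ k + d - 1 by linarith)
            nlinarith
          have : k < 5 := by exact_mod_cast this
          omega
        subst hk'
        have hd4 : d = 2 ∨ d = 3 := by omega
        rcases hd4 with rfl | rfl <;> norm_num [Nat.choose] at hDS2
      subst hd1
      refine Or.inr (Or.inr (Or.inr (Or.inl ?_)))
      funext i
      rcases i with _ | i
      · simp [lw, hone 0]
      · have h3 : lw (2 :: List.replicate (k - 1) 1) (i + 1) = lw (List.replicate (k - 1) 1) i := by
          simp [lw]
        rw [h3, lw_replicate_one]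
        split_ifs with hi
        · simp [hbot (i + 1) (by omega) (by omega)]
        · simp [hzero (i + 1) (by omega)]
end
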